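/- arXiv:2410.16800 — 8 statements merged into one kernel-verified Lean document; each statement's English description precedes it below -/
import Mathlib

section
/- Let X and Y be nonempty compact metric spaces equipped with 1-Lipschitz functions τ_X : X → ℝ and τ_Y : Y → ℝ. Then the following are equivalent: (i) for every ε > 0 there exist sequences u : ℕ → X and v : ℕ → Y with dense range such that the Hausdorff distance in ℝ × ℓ^∞ between the images of the timed-Kuratowski maps satisfies hausdorffDist(range κ_{τ_X,u}, range κ_{τ_Y,v}) < ε; (ii) there exists a bijection F : X → Y which is an isometry (dist(F x₁, F x₂) = dist(x₁, x₂) for all x₁, x₂ ∈ X) and is time preserving (τ_Y(F x) = τ_X(x) for all x ∈ X). (This says the intrinsic timed-Hausdorff distance between two compact timed-metric-spaces is zero if and only if there is a distance and time preserving bijection between them.) -/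
open Metric ENNReal

/-- The Kuratowski map of a compact metric space into `ℓ^∞`, defined from a sequence of
points: `x ↦ (n ↦ dist (u n) x)`. -/
noncomputable def kuratowskiMap {X : Type*} [MetricSpace X] [CompactSpace X]
    (u : ℕ → X) (x : X) : lp (fun _ : ℕ => ℝ) ∞ :=
  ⟨fun n => dist (u n) x, memℓp_infty ⟨Metric.diam (Set.univ : Set X), by
    rintro r ⟨n, rfl⟩
    simpa [Real.norm_eq_abs, abs_of_nonneg dist_nonneg] using
      Metric.dist_le_diam_of_mem isCompact_univ.isBounded (Set.mem_univ (u n))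
        (Set.mem_univ x)⟩⟩

/-- The timed-Kuratowski map `x ↦ (τ x, (n ↦ dist (u n) x))` into `ℝ × ℓ^∞`,
where the product carries the max product distance. -/
noncomputable def timedKuratowskiMap {X : Type*} [MetricSpace X] [CompactSpace X]
    (τ : X → ℝ) (u : ℕ → X) (x : X) : ℝ × lp (fun _ : ℕ => ℝ) ∞ :=
  (τ x, kuratowskiMap u x)

open Filter Topology

theorem Ultrafilter.exists_tendsto_of_compactSpace {ι X : Type*} [TopologicalSpace X]
    [CompactSpace X] (l : Ultrafilter ι) (f : ι → X) : ∃ x, Tendsto f l (𝓝 x) := by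
  obtain ⟨x, -, hx⟩ := isCompact_univ.ultrafilter_le_nhds (l.map f) (by simp)
  exact ⟨x, hx⟩

/-- Maps between compact metric spaces that are asymptotically distance preserving and
asymptotically surjective converge along any ultrafilter to a bijective isometry. -/
theorem exists_bijective_isometry_of_tendsto {ι X Y : Type*} [MetricSpace X] [CompactSpace X]
    [MetricSpace Y] [CompactSpace Y] (l : Ultrafilter ι) {δ : ι → ℝ} (hδ : Tendsto δ l (𝓝 0))
    (f : ι → X → Y) (g : ι → Y → X)
    (hf : ∀ i x x', |dist (f i x) (f i x') - dist x x'| ≤ δ i)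
    (hg : ∀ i y, dist (f i (g i y)) y ≤ δ i) :
    ∃ F : X → Y, Function.Bijective F ∧ Isometry F ∧
      ∀ x, Tendsto (fun i => f i x) l (𝓝 (F x)) := by
  choose F hF using fun x => l.exists_tendsto_of_compactSpace fun i => f i x
  have hiso : Isometry F := Isometry.of_dist_eq fun x x' => by
    have h := squeeze_zero (fun i => abs_nonneg _) (fun i => hf i x x') hδ
    have h' := (((hF x).dist (hF x')).sub_const (dist x x')).abs
    exact sub_eq_zero.1 (abs_eq_zero.1 (tendsto_nhds_unique h' h))
  refine ⟨F, ⟨hiso.injective, fun y => ?_⟩, hiso, hF⟩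
  obtain ⟨x, hx⟩ := l.exists_tendsto_of_compactSpace fun i => g i y
  refine ⟨x, tendsto_nhds_unique (hF x) (tendsto_iff_dist_tendsto_zero.2 ?_)⟩
  have hlim : Tendsto (fun i => dist (g i y) x + δ i + δ i) l (𝓝 0) := by
    simpa using ((tendsto_iff_dist_tendsto_zero.1 hx).add hδ).add hδ
  refine squeeze_zero (fun i => dist_nonneg) (fun i => ?_) hlim
  have h₁ := dist_triangle_left (f i x) y (f i (g i y))
  have h₂ := (abs_le.1 (hf i (g i y) x)).2
  have h₃ := hg i y
  linarith

/-- Isometric images at Hausdorff distance less than `ε` are related by maps that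
displace points by less than `ε`. -/
theorem Isometry.exists_maps_of_hausdorffDist_lt {X Y Z : Type*}
    [MetricSpace X] [CompactSpace X] [Nonempty X] [MetricSpace Y] [CompactSpace Y] [Nonempty Y]
    [MetricSpace Z] {φ : X → Z} {ψ : Y → Z} (hφ : Isometry φ) (hψ : Isometry ψ) {ε : ℝ}
    (h : hausdorffDist (Set.range φ) (Set.range ψ) < ε) :
    ∃ (f : X → Y) (g : Y → X), (∀ x, dist (φ x) (ψ (f x)) < ε) ∧
      (∀ x x', |dist (f x) (f x') - dist x x'| ≤ 2 * ε) ∧ ∀ y, dist (f (g y)) y ≤ 2 * ε := by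
  have hfin := hausdorffEDist_ne_top_of_nonempty_of_bounded (Set.range_nonempty φ)
    (Set.range_nonempty ψ) (isCompact_range hφ.continuous).isBounded
    (isCompact_range hψ.continuous).isBounded
  have hf : ∀ x, ∃ y, dist (φ x) (ψ y) < ε := fun x => by
    simpa using exists_dist_lt_of_hausdorffDist_lt (Set.mem_range_self x) h hfin
  have hg : ∀ y, ∃ x, dist (φ x) (ψ y) < ε := fun y => by
    simpa using exists_dist_lt_of_hausdorffDist_lt' (Set.mem_range_self y) h hfin
  choose f hf using hf
  choose g hg using hg
  refine ⟨f, g, hf, fun x x' => ?_, fun y => ?_⟩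
  · rw [← hψ.dist_eq, ← hφ.dist_eq, ← Real.dist_eq]
    have := dist_dist_dist_le (ψ (f x)) (ψ (f x')) (φ x) (φ x')
    rw [dist_comm (ψ _) (φ _), dist_comm (ψ _) (φ _)] at this
    linarith [hf x, hf x']
  · rw [← hψ.dist_eq]
    linarith [hf (g y), hg y, dist_triangle_left (ψ (f (g y))) (ψ y) (φ (g y))]

theorem isometry_kuratowskiMap {X : Type*} [MetricSpace X] [CompactSpace X] {u : ℕ → X}
    (hu : DenseRange u) : Isometry (kuratowskiMap u) := by
  refine Isometry.of_dist_eq fun x y => le_antisymm ?_ ?_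
  · rw [dist_eq_norm]
    refine lp.norm_le_of_forall_le dist_nonneg fun n => ?_
    exact dist_dist_dist_le_right (u n) x y
  · refine hu.induction_on (p := fun z => |dist z x - dist z y| ≤
      dist (kuratowskiMap u x) (kuratowskiMap u y)) x ?_ (fun n => ?_) |>.trans' (by simp)
    · exact isClosed_le (by fun_prop) continuous_const
    · rw [dist_eq_norm]
      exact lp.norm_apply_le_norm ENNReal.top_ne_zero (kuratowskiMap u x - kuratowskiMap u y) n

theorem isometry_timedKuratowskiMap {X : Type*} [MetricSpace X] [CompactSpace X] {τ : X → ℝ}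
    (hτ : LipschitzWith 1 τ) {u : ℕ → X} (hu : DenseRange u) :
    Isometry (timedKuratowskiMap τ u) := by
  refine Isometry.of_dist_eq fun x y => ?_
  rw [Prod.dist_eq]
  change max (dist (τ x) (τ y)) (dist (kuratowskiMap u x) (kuratowskiMap u y)) = _
  rw [(isometry_kuratowskiMap hu).dist_eq]
  exact max_eq_right (by simpa using hτ.dist_le_mul x y)

/-- The intrinsic timed-Hausdorff distance between two compact timed-metric-spaces is zero
(i.e. for every `ε > 0` there are timed-Kuratowski maps whose images in `ℝ × ℓ^∞` are at
Hausdorff distance less than `ε`) if and only if there is a distance and time preserving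
bijection between them. -/
theorem timedHausdorff_definite {X Y : Type*}
    [MetricSpace X] [CompactSpace X] [Nonempty X]
    [MetricSpace Y] [CompactSpace Y] [Nonempty Y]
    (τX : X → ℝ) (τY : Y → ℝ) (hτX : LipschitzWith 1 τX) (hτY : LipschitzWith 1 τY) :
    (∀ ε > (0 : ℝ), ∃ (u : ℕ → X) (v : ℕ → Y), DenseRange u ∧ DenseRange v ∧
        hausdorffDist (Set.range (timedKuratowskiMap τX u))
          (Set.range (timedKuratowskiMap τY v)) < ε)
      ↔ ∃ F : X → Y, Function.Bijective F ∧
          (∀ x₁ x₂ : X, dist (F x₁) (F x₂) = dist x₁ x₂) ∧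
          (∀ x : X, τY (F x) = τX x) := by
  constructor
  · intro H
    choose u v hu hv h using fun n : ℕ => H (1 / (n + 1 : ℝ)) Nat.one_div_pos_of_nat
    choose f g hfτ hf hg using fun n =>
      (isometry_timedKuratowskiMap hτX (hu n)).exists_maps_of_hausdorffDist_lt
        (isometry_timedKuratowskiMap hτY (hv n)) (h n)
    have hε : Tendsto (fun n : ℕ => 1 / (n + 1 : ℝ)) (hyperfilter ℕ) (𝓝 0) :=
      tendsto_one_div_add_atTop_nhds_zero_nat.mono_left Nat.hyperfilter_le_atTop
    obtain ⟨F, hbij, hiso, hF⟩ := exists_bijective_isometry_of_tendsto (hyperfilter ℕ)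
      (by simpa using hε.const_mul 2) f g hf hg
    refine ⟨F, hbij, hiso.dist_eq, fun x => ?_⟩
    refine tendsto_nhds_unique ((hτY.continuous.tendsto _).comp (hF x))
      (tendsto_iff_dist_tendsto_zero.2 (squeeze_zero (fun n => dist_nonneg) (fun n => ?_) hε))
    rw [dist_comm]
    exact (le_max_left _ _).trans (hfτ n x).le
  · rintro ⟨F, hbij, hdist, hτ⟩ ε hε
    have hu := TopologicalSpace.denseRange_denseSeq X
    refine ⟨_, F ∘ TopologicalSpace.denseSeq X, hu,
      hbij.surjective.denseRange.comp hu (Isometry.of_dist_eq hdist).continuous, ?_⟩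
    have hcomp : timedKuratowskiMap τY (F ∘ TopologicalSpace.denseSeq X) ∘ F =
        timedKuratowskiMap τX (TopologicalSpace.denseSeq X) := by
      ext x : 1
      simp [timedKuratowskiMap, kuratowskiMap, hdist, hτ]
    rwa [← hcomp, hbij.surjective.range_comp, hausdorffDist_self_zero]
end

section
/- Let X and Y be nonempty compact metric spaces with basepoints p ∈ X and q ∈ Y, and define time functions τ_X(x) = dist(x, p) and τ_Y(y) = dist(y, q). Then the following are equivalent: (i) for every ε > 0 there exist a metric space Z and isometric embeddings φ : X → Z and ψ : Y → Z such that hausdorffDist(φ '' Set.univ, ψ '' Set.univ) + dist(φ p, ψ q) < ε; (ii) there exists a bijection F : X → Y which is an isometry and satisfies F p = q, and hence is time preserving: dist(F x, q) = dist(x, p) for all x ∈ X. (This says the pointed (big-bang) Gromov–Hausdorff distance between two compact big bang timed-metric-spaces is zero if and only if there is a distance and time preserving bijection between them.) -/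
open Metric

/-- Two compact spaces that admit, for every `ε > 0`, maps `F : X → Y` and `G : Y → X` which are
adjoint for the distances up to `ε` also admit exactly adjoint maps. -/
theorem exists_dist_eq_of_approx {X Y : Type*} [MetricSpace X] [CompactSpace X]
    [MetricSpace Y] [CompactSpace Y] (p : X) (q : Y)
    (h : ∀ ε > (0 : ℝ), ∃ (F : X → Y) (G : Y → X),
      (∀ x y, |dist (F x) y - dist x (G y)| ≤ ε) ∧ dist (F p) q ≤ ε) :
    ∃ (F : X → Y) (G : Y → X), (∀ x y, dist (F x) y = dist x (G y)) ∧ F p = q := by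
  let K : Set.Ioi (0 : ℝ) → Set ((X → Y) × (Y → X)) := fun ε =>
    {f | (∀ x y, |dist (f.1 x) y - dist x (f.2 y)| ≤ ε) ∧ dist (f.1 p) q ≤ ε}
  have hmono : Monotone K := fun ε δ hεδ f hf =>
    ⟨fun x y => (hf.1 x y).trans hεδ, hf.2.trans hεδ⟩
  have hclosed (ε) : IsClosed (K ε) := by
    have h₁ : IsClosed {f : (X → Y) × (Y → X) |
        ∀ x y, |dist (f.1 x) y - dist x (f.2 y)| ≤ ε} := by
      simp only [Set.ofPred_forall]
      exact isClosed_iInter fun x => isClosed_iInter fun y =>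
        isClosed_le (by fun_prop) continuous_const
    have h₂ : IsClosed {f : (X → Y) × (Y → X) | dist (f.1 p) q ≤ ε} :=
      isClosed_le (by fun_prop) continuous_const
    exact h₁.inter h₂
  have : Nonempty (Set.Ioi (0 : ℝ)) := ⟨⟨1, Set.mem_Ioi.mpr one_pos⟩⟩
  obtain ⟨⟨F, G⟩, hFG⟩ := IsCompact.nonempty_iInter_of_directed_nonempty_isCompact_isClosed K
    hmono.directed_ge
    (fun ε => by
      obtain ⟨F, G, hFG⟩ := h ε ε.2
      exact ⟨(F, G), hFG⟩)
    (fun ε => (hclosed ε).isCompact) hclosed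
  rw [Set.mem_iInter] at hFG
  refine ⟨F, G, fun x y => ?_, ?_⟩
  · exact sub_eq_zero.mp <| abs_nonpos_iff.mp <|
      le_of_forall_pos_le_add fun ε hε => by simpa using (hFG ⟨ε, hε⟩).1 x y
  · exact dist_le_zero.mp <|
      le_of_forall_pos_le_add fun ε hε => by simpa using (hFG ⟨ε, hε⟩).2

/-- Isometric copies at small Hausdorff distance give approximately adjoint maps. -/
theorem exists_approx_of_hausdorffDist_lt {X Y Z : Type*} [MetricSpace X] [CompactSpace X]
    [MetricSpace Y] [CompactSpace Y] [MetricSpace Z] {φ : X → Z} {ψ : Y → Z}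
    (hφ : Isometry φ) (hψ : Isometry ψ) {p : X} {q : Y} {δ : ℝ}
    (hH : hausdorffDist (φ '' Set.univ) (ψ '' Set.univ) < δ) (hpq : dist (φ p) (ψ q) < δ) :
    ∃ (F : X → Y) (G : Y → X),
      (∀ x y, |dist (F x) y - dist x (G y)| ≤ 2 * δ) ∧ dist (F p) q ≤ 2 * δ := by
  have hfin : hausdorffEDist (φ '' Set.univ) (ψ '' Set.univ) ≠ ⊤ :=
    hausdorffEDist_ne_top_of_nonempty_of_bounded ⟨φ p, p, trivial, rfl⟩ ⟨ψ q, q, trivial, rfl⟩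
      (isCompact_univ.image hφ.continuous).isBounded
      (isCompact_univ.image hψ.continuous).isBounded
  have hF (x : X) : ∃ y, dist (φ x) (ψ y) < δ := by
    obtain ⟨_, ⟨y, -, rfl⟩, hy⟩ :=
      exists_dist_lt_of_hausdorffDist_lt (Set.mem_image_of_mem φ (Set.mem_univ x)) hH hfin
    exact ⟨y, hy⟩
  have hG (y : Y) : ∃ x, dist (φ x) (ψ y) < δ := by
    obtain ⟨_, ⟨x, -, rfl⟩, hx⟩ :=
      exists_dist_lt_of_hausdorffDist_lt' (Set.mem_image_of_mem ψ (Set.mem_univ y)) hH hfin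
    exact ⟨x, hx⟩
  choose F hF using hF
  choose G hG using hG
  refine ⟨F, G, fun x y => ?_, ?_⟩
  · rw [← hψ.dist_eq, ← hφ.dist_eq, ← Real.dist_eq]
    calc dist (dist (ψ (F x)) (ψ y)) (dist (φ x) (φ (G y)))
        ≤ dist (ψ (F x)) (φ x) + dist (ψ y) (φ (G y)) := dist_dist_dist_le _ _ _ _
      _ ≤ 2 * δ := by
        rw [dist_comm (ψ (F x)), dist_comm (ψ y)]
        linarith [hF x, hG y]
  · rw [← hψ.dist_eq]
    linarith [dist_triangle_left (ψ (F p)) (ψ q) (φ p), hF p]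

/-- The pointed (big-bang) Gromov–Hausdorff distance between two compact big bang
timed-metric-spaces (nonempty compact metric spaces with basepoints, whose time
functions are the distances to the basepoints) is zero if and only if there is a
distance and time preserving bijection matching the big bang points. -/
theorem bigBang_GH_definite {X Y : Type}
    [MetricSpace X] [CompactSpace X] [Nonempty X]
    [MetricSpace Y] [CompactSpace Y] [Nonempty Y]
    (p : X) (q : Y) :
    (∀ ε > (0 : ℝ), ∃ (Z : Type) (_ : MetricSpace Z) (φ : X → Z) (ψ : Y → Z),
        (∀ x₁ x₂ : X, dist (φ x₁) (φ x₂) = dist x₁ x₂) ∧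
        (∀ y₁ y₂ : Y, dist (ψ y₁) (ψ y₂) = dist y₁ y₂) ∧
        hausdorffDist (φ '' Set.univ) (ψ '' Set.univ) + dist (φ p) (ψ q) < ε)
      ↔ ∃ F : X → Y, Function.Bijective F ∧
          (∀ x₁ x₂ : X, dist (F x₁) (F x₂) = dist x₁ x₂) ∧
          F p = q ∧
          (∀ x : X, dist (F x) q = dist x p) := by
  constructor
  · intro h
    obtain ⟨F, G, hFG, hpq⟩ := exists_dist_eq_of_approx p q fun ε hε => by
      obtain ⟨Z, _, φ, ψ, hφ, hψ, hlt⟩ := h (ε / 2) (half_pos hε)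
      have := hausdorffDist_nonneg (s := φ '' Set.univ) (t := ψ '' Set.univ)
      have := dist_nonneg (x := φ p) (y := ψ q)
      simpa [mul_div_cancel₀] using exists_approx_of_hausdorffDist_lt (δ := ε / 2)
        (Isometry.of_dist_eq hφ) (Isometry.of_dist_eq hψ) (p := p) (q := q)
        (by linarith) (by linarith)
    have hGF (x : X) : G (F x) = x := by
      rw [eq_comm, ← dist_eq_zero, ← hFG, dist_self]
    have hF (y : Y) : F (G y) = y := by
      rw [← dist_eq_zero, hFG, dist_self]
    have hiso (x₁ x₂ : X) : dist (F x₁) (F x₂) = dist x₁ x₂ := by rw [hFG, hGF]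
    exact ⟨F, ⟨Function.LeftInverse.injective hGF, Function.RightInverse.surjective hF⟩, hiso,
      hpq, fun x => by rw [← hpq, hiso]⟩
  · rintro ⟨F, hbij, hiso, hpq, -⟩ ε hε
    refine ⟨Y, inferInstance, F, id, hiso, fun _ _ => rfl, ?_⟩
    simpa [Set.image_univ, hbij.surjective.range_eq, hpq] using hε
end

section
/- Let X and Y be nonempty compact metric spaces, let A ⊆ X and B ⊆ Y be nonempty closed subsets, and define time functions τ_X(x) = infDist(x, A) and τ_Y(y) = infDist(y, B). Then the following are equivalent: (i) for every ε > 0 there exist a metric space Z and isometric embeddings φ : X → Z and ψ : Y → Z such that hausdorffDist(φ '' Set.univ, ψ '' Set.univ) + hausdorffDist(φ '' A, ψ '' B) < ε; (ii) there exists a bijection F : X → Y which is an isometry, maps A onto B (F '' A = B), and is time preserving: infDist(F x, B) = infDist(x, A) for all x ∈ X. (This says the intrinsic FD-HH distance between two compact future-developed timed-metric-spaces, whose time functions are the distances to their initial data sets, is zero if and only if there is a distance and time preserving bijection carrying one initial data set onto the other.) -/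
open Metric

open Filter Topology

/-- If two compact spaces and distinguished subsets have Hausdorff-close isometric images, each point
of the first has a nearby partner in the second, chosen inside the second subset on the first. -/
theorem exists_dist_lt_mapsTo_of_hausdorffDist_lt {X Y Z : Type*}
    [PseudoMetricSpace X] [CompactSpace X] [Nonempty X]
    [PseudoMetricSpace Y] [CompactSpace Y] [Nonempty Y] [PseudoMetricSpace Z]
    {A : Set X} {B : Set Y} (hA : A.Nonempty) (hB : B.Nonempty)
    {φ : X → Z} {ψ : Y → Z} (hφ : Isometry φ) (hψ : Isometry ψ) {ε : ℝ}
    (huniv : hausdorffDist (φ '' Set.univ) (ψ '' Set.univ) < ε)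
    (hsub : hausdorffDist (φ '' A) (ψ '' B) < ε) :
    ∃ f : X → Y, (∀ x, dist (φ x) (ψ (f x)) < ε) ∧ Set.MapsTo f A B := by
  have finite (S : Set X) (T : Set Y) (hS : S.Nonempty) (hT : T.Nonempty) :
      hausdorffEDist (φ '' S) (ψ '' T) ≠ ⊤ :=
    hausdorffEDist_ne_top_of_nonempty_of_bounded (hS.image φ) (hT.image ψ)
      (hφ.lipschitz.isBounded_image (isCompact_univ.isBounded.subset S.subset_univ))
      (hψ.lipschitz.isBounded_image (isCompact_univ.isBounded.subset T.subset_univ))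
  have key (x : X) : ∃ y : Y, dist (φ x) (ψ y) < ε ∧ (x ∈ A → y ∈ B) := by
    by_cases hx : x ∈ A
    · obtain ⟨_, ⟨y, hy, rfl⟩, hxy⟩ := exists_dist_lt_of_hausdorffDist_lt
        (Set.mem_image_of_mem φ hx) hsub (finite A B hA hB)
      exact ⟨y, hxy, fun _ => hy⟩
    · obtain ⟨_, ⟨y, -, rfl⟩, hxy⟩ := exists_dist_lt_of_hausdorffDist_lt
        (Set.mem_image_of_mem φ (Set.mem_univ x)) huniv
        (finite _ _ Set.univ_nonempty Set.univ_nonempty)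
      exact ⟨y, hxy, fun h => absurd h hx⟩
  choose f hf using key
  exact ⟨f, fun x => (hf x).1, fun x hx => (hf x).2 hx⟩

/-- Almost-isometries with almost-inverses between compact metric spaces, with errors tending to
zero, produce an isometry carrying one distinguished closed subset onto the other. -/
theorem exists_isometryEquiv_image_eq_of_almost {X Y : Type*}
    [MetricSpace X] [CompactSpace X] [MetricSpace Y] [CompactSpace Y]
    {A : Set X} {B : Set Y} (hA : IsClosed A) (hB : IsClosed B)
    (h : ∀ ε > (0 : ℝ), ∃ (f : X → Y) (g : Y → X),
      (∀ x x', |dist (f x) (f x') - dist x x'| ≤ ε) ∧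
      (∀ x y, dist (f x) y ≤ dist x (g y) + ε) ∧ Set.MapsTo f A B ∧ Set.MapsTo g B A) :
    ∃ F : X ≃ᵢ Y, F '' A = B := by
  choose f g hf hfg hfA hgB using fun n : ℕ => h (1 / ((n : ℝ) + 1)) Nat.one_div_pos_of_nat
  let l : Ultrafilter ℕ := hyperfilter ℕ
  have hε : Tendsto (fun n : ℕ => 1 / ((n : ℝ) + 1)) l (𝓝 0) :=
    tendsto_one_div_add_atTop_nhds_zero_nat.mono_left Nat.hyperfilter_le_atTop
  have limF (x : X) : ∃ y, Tendsto (fun n => f n x) l (𝓝 y) :=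
    ⟨_, (l.map fun n => f n x).le_nhds_lim⟩
  have limG (y : Y) : ∃ x, Tendsto (fun n => g n y) l (𝓝 x) :=
    ⟨_, (l.map fun n => g n y).le_nhds_lim⟩
  choose F hF using limF
  choose G hG using limG
  have isoF : Isometry F := Isometry.of_dist_eq fun x x' => by
    have hdiff : Tendsto (fun n => dist (f n x) (f n x') - dist x x') l (𝓝 0) :=
      squeeze_zero_norm (fun n => hf n x x') hε
    exact sub_eq_zero.mp
      (tendsto_nhds_unique (((hF x).dist (hF x')).sub_const (dist x x')) hdiff)
  have FG (y : Y) : F (G y) = y := by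
    have hle : dist (F (G y)) y ≤ dist (G y) (G y) + 0 :=
      le_of_tendsto_of_tendsto' ((hF (G y)).dist tendsto_const_nhds)
        ((tendsto_const_nhds.dist (hG y)).add hε) fun n => hfg n (G y) y
    exact dist_le_zero.mp (by simpa using hle)
  refine ⟨IsometryEquiv.mk' F G FG isoF, Set.Subset.antisymm ?_ fun y hy => ?_⟩
  · rintro _ ⟨x, hx, rfl⟩
    exact hB.mem_of_tendsto (hF x) (Eventually.of_forall fun n => hfA n hx)
  · exact ⟨G y, hA.mem_of_tendsto (hG y) (Eventually.of_forall fun n => hgB n hy), FG y⟩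

/-- The intrinsic FD-HH distance between two compact future-developed
timed-metric-spaces (nonempty compact metric spaces with nonempty closed initial data
sets, whose time functions are the distances to the initial data sets) is zero if and
only if there is a distance and time preserving bijection carrying one initial data set
onto the other. -/
theorem futureDeveloped_HH_definite {X Y : Type}
    [MetricSpace X] [CompactSpace X] [Nonempty X]
    [MetricSpace Y] [CompactSpace Y] [Nonempty Y]
    (A : Set X) (B : Set Y) (hA : A.Nonempty) (hB : B.Nonempty)
    (hAc : IsClosed A) (hBc : IsClosed B) :
    (∀ ε > (0 : ℝ), ∃ (Z : Type) (_ : MetricSpace Z) (φ : X → Z) (ψ : Y → Z),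
        (∀ x₁ x₂ : X, dist (φ x₁) (φ x₂) = dist x₁ x₂) ∧
        (∀ y₁ y₂ : Y, dist (ψ y₁) (ψ y₂) = dist y₁ y₂) ∧
        hausdorffDist (φ '' Set.univ) (ψ '' Set.univ) +
          hausdorffDist (φ '' A) (ψ '' B) < ε)
      ↔ ∃ F : X → Y, Function.Bijective F ∧
          (∀ x₁ x₂ : X, dist (F x₁) (F x₂) = dist x₁ x₂) ∧
          F '' A = B ∧
          (∀ x : X, infDist (F x) B = infDist x A) := by
  constructor
  · intro h
    obtain ⟨F, hF⟩ := exists_isometryEquiv_image_eq_of_almost hAc hBc fun ε hε => by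
      obtain ⟨Z, _, φ, ψ, hφ, hψ, hlt⟩ := h (ε / 2) (half_pos hε)
      have huniv : hausdorffDist (φ '' Set.univ) (ψ '' Set.univ) < ε / 2 :=
        (le_add_of_nonneg_right hausdorffDist_nonneg).trans_lt hlt
      have hsub : hausdorffDist (φ '' A) (ψ '' B) < ε / 2 :=
        (le_add_of_nonneg_left hausdorffDist_nonneg).trans_lt hlt
      have isoφ := Isometry.of_dist_eq hφ
      have isoψ := Isometry.of_dist_eq hψ
      obtain ⟨f, hf, hfA⟩ :=
        exists_dist_lt_mapsTo_of_hausdorffDist_lt hA hB isoφ isoψ huniv hsub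
      obtain ⟨g, hg, hgB⟩ := exists_dist_lt_mapsTo_of_hausdorffDist_lt hB hA isoψ isoφ
        (hausdorffDist_comm.trans_lt huniv) (hausdorffDist_comm.trans_lt hsub)
      refine ⟨f, g, fun x x' => ?_, fun x y => ?_, hfA, hgB⟩
      · rw [← hφ, ← hψ, ← Real.dist_eq]
        have hquad := dist_dist_dist_le (ψ (f x)) (ψ (f x')) (φ x) (φ x')
        rw [dist_comm (ψ (f x)) (φ x), dist_comm (ψ (f x')) (φ x')] at hquad
        linarith [hf x, hf x']
      · rw [← hφ, ← hψ]
        have hquad := dist_triangle4 (ψ (f x)) (φ x) (φ (g y)) (ψ y)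
        rw [dist_comm (ψ (f x)) (φ x), dist_comm (φ (g y)) (ψ y)] at hquad
        linarith [hf x, hg y]
    refine ⟨F, F.bijective, F.isometry.dist_eq, hF, fun x => ?_⟩
    rw [← hF, infDist_image F.isometry]
  · rintro ⟨F, hbij, hiso, hAB, -⟩ ε hε
    refine ⟨Y, inferInstance, F, id, hiso, fun _ _ => rfl, ?_⟩
    rw [Set.image_id, Set.image_id, hAB, Set.image_univ, hbij.surjective.range_eq,
      hausdorffDist_self_zero, hausdorffDist_self_zero, add_zero]
    exact hε
end

section
/- Let X and Y be nonempty compact metric spaces with 1-Lipschitz functions τ_X : X → ℝ and τ_Y : Y → ℝ. Suppose that for every ε > 0 there exists a map F : X → Y such that: (a) |τ_Y(F x) − τ_X(x)| ≤ ε for all x ∈ X; (b) |dist(F x₁, F x₂) − dist(x₁, x₂)| ≤ ε for all x₁, x₂ ∈ X; and (c) for every y ∈ Y there exists x ∈ X with dist(F x, y) ≤ ε. Then there exists a bijection G : X → Y which is an isometry and satisfies τ_Y ∘ G = τ_X. -/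
open Metric

/-- In a compact space every sequence converges along every ultrafilter. -/
theorem Ultrafilter.exists_tendsto_of_compactSpace_s9 {ι Z : Type*} [TopologicalSpace Z]
    [CompactSpace Z] (U : Ultrafilter ι) (f : ι → Z) :
    ∃ z, Filter.Tendsto f U (nhds z) :=
  ⟨_, (U.map f).le_nhds_lim⟩

/-- Grove–Petersen style limit step with time functions: if for every `ε > 0` there is a
map between two compact timed-metric-spaces that is `ε`-almost time preserving,
`ε`-almost distance preserving and `ε`-almost onto, then there is a distance and time
preserving bijection between them. -/
theorem almost_isometries_to_isometry {X Y : Type*}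
    [MetricSpace X] [CompactSpace X] [Nonempty X]
    [MetricSpace Y] [CompactSpace Y] [Nonempty Y]
    (τX : X → ℝ) (τY : Y → ℝ) (hτX : LipschitzWith 1 τX) (hτY : LipschitzWith 1 τY)
    (h : ∀ ε > (0 : ℝ), ∃ F : X → Y,
        (∀ x : X, |τY (F x) - τX x| ≤ ε) ∧
        (∀ x₁ x₂ : X, |dist (F x₁) (F x₂) - dist x₁ x₂| ≤ ε) ∧
        (∀ y : Y, ∃ x : X, dist (F x) y ≤ ε)) :
    ∃ G : X → Y, Function.Bijective G ∧
      (∀ x₁ x₂ : X, dist (G x₁) (G x₂) = dist x₁ x₂) ∧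
      (∀ x : X, τY (G x) = τX x) := by
  obtain ⟨u, -, hu_pos, hu⟩ := exists_seq_strictAnti_tendsto (0 : ℝ)
  choose F hFτ hFd hFs using fun n => h (u n) (hu_pos n)
  let U : Ultrafilter ℕ := Filter.hyperfilter ℕ
  have hU : Filter.Tendsto u U (nhds 0) := hu.mono_left Nat.hyperfilter_le_atTop
  choose G hG using fun x => U.exists_tendsto_of_compactSpace_s9 fun n => F n x
  have hGd : ∀ x₁ x₂ : X, dist (G x₁) (G x₂) = dist x₁ x₂ := fun x₁ x₂ =>
    tendsto_nhds_unique ((hG x₁).dist (hG x₂)) <| tendsto_iff_dist_tendsto_zero.2 <|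
      squeeze_zero (fun _ => dist_nonneg) (fun n => hFd n x₁ x₂) hU
  refine ⟨G, ⟨(Isometry.of_dist_eq hGd).injective, fun y => ?_⟩, hGd, fun x => ?_⟩
  · choose x hx using fun n => hFs n y
    obtain ⟨z, hz⟩ := U.exists_tendsto_of_compactSpace_s9 x
    refine ⟨z, tendsto_nhds_unique (hG z) <| tendsto_iff_dist_tendsto_zero.2 ?_⟩
    have hlim : Filter.Tendsto (fun n => dist z (x n) + u n + u n) U (nhds 0) := by
      simpa using (((tendsto_const_nhds (x := z)).dist hz).add hU).add hU
    refine squeeze_zero (fun _ => dist_nonneg) (fun n => ?_) hlim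
    have hd := (abs_le.1 (hFd n z (x n))).2
    linarith [dist_triangle (F n z) (F n (x n)) y, hx n]
  · exact tendsto_nhds_unique ((hτY.continuous.tendsto (G x)).comp (hG x)) <|
      tendsto_iff_dist_tendsto_zero.2 <|
        squeeze_zero (fun _ => dist_nonneg) (fun n => hFτ n x) hU
end

section
/- Let X and Y be nonempty compact metric spaces, let A ⊆ X and B ⊆ Y be nonempty subsets, let Z be a metric space, let φ : X → Z and ψ : Y → Z be isometric embeddings, and let ε > 0. Suppose hausdorffDist(φ '' Set.univ, ψ '' Set.univ) < ε and hausdorffDist(φ '' A, ψ '' B) < ε. Then there exists a map F : X → Y such that F '' A ⊆ B, dist(φ x, ψ (F x)) < ε for all x ∈ X, and consequently |dist(F x₁, F x₂) − dist(x₁, x₂)| < 2ε for all x₁, x₂ ∈ X. -/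
open Metric

/-- If the images of nonempty subsets of two compact spaces under isometries are at Hausdorff
distance less than `r`, then every point of the first subset has a point of the second within
distance `r` of it. -/
theorem exists_mem_dist_lt_of_hausdorffDist_image_lt {X Y Z : Type*}
    [PseudoMetricSpace X] [CompactSpace X] [PseudoMetricSpace Y] [CompactSpace Y]
    [PseudoMetricSpace Z] {φ : X → Z} {ψ : Y → Z} (hφ : Isometry φ) (hψ : Isometry ψ)
    {s : Set X} {t : Set Y} (ht : t.Nonempty) {r : ℝ}
    (h : hausdorffDist (φ '' s) (ψ '' t) < r) {x : X} (hx : x ∈ s) :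
    ∃ y ∈ t, dist (φ x) (ψ y) < r := by
  have hfin : hausdorffEDist (φ '' s) (ψ '' t) ≠ ⊤ :=
    hausdorffEDist_ne_top_of_nonempty_of_bounded (Set.Nonempty.image φ ⟨x, hx⟩) (ht.image ψ)
      (hφ.lipschitz.isBounded_image isBounded_of_compactSpace)
      (hψ.lipschitz.isBounded_image isBounded_of_compactSpace)
  obtain ⟨_, ⟨y, hy, rfl⟩, hxy⟩ :=
    exists_dist_lt_of_hausdorffDist_lt (Set.mem_image_of_mem φ hx) h hfin
  exact ⟨y, hy, hxy⟩

/-- Intermediate construction in the proof that the intrinsic FD-HH distance is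
definite: if two isometric embeddings into a common metric space `Z` have images at
Hausdorff distance less than `ε`, and the images of the initial data sets are also at
Hausdorff distance less than `ε`, then there is a map `F : X → Y` carrying `A` into `B`,
with `dist (φ x) (ψ (F x)) < ε` for all `x`, and which is `2ε`-almost distance
preserving. -/
theorem almost_isometry_of_hausdorffDist_lt {X Y Z : Type*}
    [MetricSpace X] [CompactSpace X] [Nonempty X]
    [MetricSpace Y] [CompactSpace Y] [Nonempty Y]
    [MetricSpace Z]
    (A : Set X) (B : Set Y) (hA : A.Nonempty) (hB : B.Nonempty)
    (φ : X → Z) (ψ : Y → Z)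
    (hφ : ∀ x₁ x₂ : X, dist (φ x₁) (φ x₂) = dist x₁ x₂)
    (hψ : ∀ y₁ y₂ : Y, dist (ψ y₁) (ψ y₂) = dist y₁ y₂)
    (ε : ℝ) (hε : 0 < ε)
    (h₁ : hausdorffDist (φ '' Set.univ) (ψ '' Set.univ) < ε)
    (h₂ : hausdorffDist (φ '' A) (ψ '' B) < ε) :
    ∃ F : X → Y, F '' A ⊆ B ∧
      (∀ x : X, dist (φ x) (ψ (F x)) < ε) ∧
      (∀ x₁ x₂ : X, |dist (F x₁) (F x₂) - dist x₁ x₂| < 2 * ε) := by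
  have hφi : Isometry φ := Isometry.of_dist_eq hφ
  have hψi : Isometry ψ := Isometry.of_dist_eq hψ
  have hF : ∀ x, ∃ y, (x ∈ A → y ∈ B) ∧ dist (φ x) (ψ y) < ε := by
    intro x
    by_cases hx : x ∈ A
    · obtain ⟨y, hy, hxy⟩ := exists_mem_dist_lt_of_hausdorffDist_image_lt hφi hψi hB h₂ hx
      exact ⟨y, fun _ => hy, hxy⟩
    · obtain ⟨y, -, hxy⟩ := exists_mem_dist_lt_of_hausdorffDist_image_lt hφi hψi
        Set.univ_nonempty h₁ (Set.mem_univ x)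
      exact ⟨y, fun h => absurd h hx, hxy⟩
  choose F hFB hFε using hF
  refine ⟨F, Set.image_subset_iff.2 hFB, hFε, fun x₁ x₂ => ?_⟩
  rw [← hψ, ← hφ x₁ x₂, ← Real.dist_eq]
  have := dist_dist_dist_le (ψ (F x₁)) (ψ (F x₂)) (φ x₁) (φ x₂)
  rw [dist_comm (ψ (F x₁)) (φ x₁), dist_comm (ψ (F x₂)) (φ x₂)] at this
  linarith [hFε x₁, hFε x₂]
end

section
/- Fix n ∈ ℕ and let M = ℝ × EuclideanSpace ℝ (Fin n) be Minkowski space with time function τ(p) = p.1. Then for all p, q ∈ M, the null distance equals d̂(p, q) = max(|p.1 − q.1|, dist(p.2, q.2)). -/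
open Metric

/-- The causal relation on Minkowski space `ℝ × EuclideanSpace ℝ (Fin n)` with time
function the first coordinate: `q ≼ p` iff `dist q.2 p.2 ≤ p.1 - q.1`. -/
def MinkCausal {n : ℕ} (q p : ℝ × EuclideanSpace ℝ (Fin n)) : Prop :=
  dist q.2 p.2 ≤ p.1 - q.1

/-- A null chain from `p` to `q`: a finite sequence `c 0 = p, …, c (2N) = q` alternating
past-directed and future-directed causal steps, i.e. `c (2i+1) ≼ c (2i)` and
`c (2i+1) ≼ c (2i+2)` for all `i < N`. -/
def IsNullChain {n : ℕ} (p q : ℝ × EuclideanSpace ℝ (Fin n)) (N : ℕ)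
    (c : ℕ → ℝ × EuclideanSpace ℝ (Fin n)) : Prop :=
  c 0 = p ∧ c (2 * N) = q ∧
    ∀ i < N, MinkCausal (c (2 * i + 1)) (c (2 * i)) ∧
      MinkCausal (c (2 * i + 1)) (c (2 * i + 2))

/-- The null length of a chain: the sum of the absolute time differences along the
chain. -/
noncomputable def nullLength {n : ℕ} (N : ℕ)
    (c : ℕ → ℝ × EuclideanSpace ℝ (Fin n)) : ℝ :=
  ∑ i ∈ Finset.range (2 * N), |(c (i + 1)).1 - (c i).1|

/-- The null distance on Minkowski space: the infimum of the null lengths of all null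
chains from `p` to `q`. -/
noncomputable def nullDist {n : ℕ} (p q : ℝ × EuclideanSpace ℝ (Fin n)) : ℝ :=
  sInf {L | ∃ (N : ℕ) (c : ℕ → ℝ × EuclideanSpace ℝ (Fin n)),
    IsNullChain p q N c ∧ L = nullLength N c}

/-- The restricted null distance on a subset `S` of Minkowski space: the infimum of the
null lengths of all null chains from `p` to `q` whose points all lie in `S`. -/
noncomputable def nullDistIn {n : ℕ} (S : Set (ℝ × EuclideanSpace ℝ (Fin n)))
    (p q : ℝ × EuclideanSpace ℝ (Fin n)) : ℝ :=
  sInf {L | ∃ (N : ℕ) (c : ℕ → ℝ × EuclideanSpace ℝ (Fin n)),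
    IsNullChain p q N c ∧ (∀ i ≤ 2 * N, c i ∈ S) ∧ L = nullLength N c}

theorem MinkCausal.dist_le {n : ℕ} {q p : ℝ × EuclideanSpace ℝ (Fin n)}
    (h : MinkCausal q p) : dist q p ≤ |p.1 - q.1| := by
  rw [Prod.dist_eq, Real.dist_eq, abs_sub_comm q.1 p.1]
  exact max_le le_rfl (h.trans (le_abs_self _))

theorem IsNullChain.dist_le_nullLength {n N : ℕ} {p q : ℝ × EuclideanSpace ℝ (Fin n)}
    {c : ℕ → ℝ × EuclideanSpace ℝ (Fin n)} (h : IsNullChain p q N c) :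
    dist p q ≤ nullLength N c := by
  obtain ⟨rfl, rfl, hc⟩ := h
  refine (dist_le_range_sum_dist c (2 * N)).trans (Finset.sum_le_sum fun i hi => ?_)
  have hi := Finset.mem_range.mp hi
  obtain ⟨k, rfl | rfl⟩ := i.even_or_odd'
  · rw [dist_comm, abs_sub_comm]
    exact (hc k (by lia)).1.dist_le
  · exact (hc k (by lia)).2.dist_le

/-- The infimum defining the null distance is attained by a chain with one intermediate
point. -/
theorem exists_isNullChain_nullLength_eq_dist {n : ℕ} (p q : ℝ × EuclideanSpace ℝ (Fin n)) :
    ∃ c, IsNullChain p q 1 c ∧ nullLength 1 c = dist p q := by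
  have hM : |p.1 - q.1| ≤ dist p q := le_max_left _ _
  have hD : dist p.2 q.2 ≤ dist p q := le_max_right _ _
  obtain ⟨h₁, h₂⟩ := abs_le.mp hM
  obtain ⟨z, hz₁, hz₂⟩ := exists_dist_le_le (x := p.2) (z := q.2)
    (δ := (dist p q + (p.1 - q.1)) / 2) (ε := (dist p q - (p.1 - q.1)) / 2)
    (by linarith) (by linarith) (by linarith)
  let r : ℝ × EuclideanSpace ℝ (Fin n) := ((p.1 + q.1 - dist p q) / 2, z)
  refine ⟨fun i => if i = 0 then p else if i = 1 then r else q, ⟨rfl, rfl, ?_⟩, ?_⟩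
  · intro i hi
    obtain rfl : i = 0 := by lia
    simp only [MinkCausal, r]
    refine ⟨?_, ?_⟩
    · rw [dist_comm] at hz₁
      norm_num
      linarith
    · norm_num
      linarith
  · have hp : r.1 - p.1 ≤ 0 := by simp only [r]; linarith
    have hq : 0 ≤ q.1 - r.1 := by simp only [r]; linarith
    simp only [nullLength, mul_one, Finset.sum_range_succ, Finset.sum_range_zero]
    norm_num
    rw [abs_of_nonpos hp, abs_of_nonneg hq]
    simp only [r]
    ring


/-- On Minkowski space `ℝ × EuclideanSpace ℝ (Fin n)` with time function the first
coordinate, the null distance is `max |p.1 - q.1| (dist p.2 q.2)`. -/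
theorem nullDist_minkowski (n : ℕ) (p q : ℝ × EuclideanSpace ℝ (Fin n)) :
    nullDist p q = max |p.1 - q.1| (dist p.2 q.2) := by
  have h : IsLeast {L | ∃ (N : ℕ) (c : ℕ → ℝ × EuclideanSpace ℝ (Fin n)),
      IsNullChain p q N c ∧ L = nullLength N c} (dist p q) := by
    refine ⟨?_, ?_⟩
    · obtain ⟨c, hc, hL⟩ := exists_isNullChain_nullLength_eq_dist p q
      exact ⟨1, c, hc, hL.symm⟩
    · rintro _ ⟨N, c, hc, rfl⟩
      exact hc.dist_le_nullLength
  exact h.csInf_eq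
end

section
/- Fix n ∈ ℕ and a > 0, and let N = {(t, x) ∈ ℝ × EuclideanSpace ℝ (Fin n) : 0 ≤ t ≤ a} be a slab of Minkowski space. Define the restricted null distance d̂_N(p, q), for p, q ∈ N, as the infimum of the null lengths of null chains from p to q all of whose points lie in N. Then for all (t₁, x₁), (t₂, x₂) ∈ N, d̂_N((t₁, x₁), (t₂, x₂)) = max(|t₁ − t₂|, dist(x₁, x₂)). -/
open Metric

/-- There is a null chain in `S` from `p` to `q` of null length `L`. -/
def HasNullChainIn {n : ℕ} (S : Set (ℝ × EuclideanSpace ℝ (Fin n)))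
    (p q : ℝ × EuclideanSpace ℝ (Fin n)) (L : ℝ) : Prop :=
  ∃ (N : ℕ) (c : ℕ → ℝ × EuclideanSpace ℝ (Fin n)),
    IsNullChain p q N c ∧ (∀ i ≤ 2 * N, c i ∈ S) ∧ L = nullLength N c

namespace HasNullChainIn

variable {n : ℕ} {S : Set (ℝ × EuclideanSpace ℝ (Fin n))}
  {p q r : ℝ × EuclideanSpace ℝ (Fin n)} {L L' : ℝ}

theorem trans (h : HasNullChainIn S p q L) (h' : HasNullChainIn S q r L') :
    HasNullChainIn S p r (L + L') := by
  obtain ⟨N, c, ⟨hc0, hcN, hc⟩, hcS, rfl⟩ := h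
  obtain ⟨M, d, ⟨hd0, hdM, hd⟩, hdS, rfl⟩ := h'
  set e : ℕ → ℝ × EuclideanSpace ℝ (Fin n) :=
    fun i => if i ≤ 2 * N then c i else d (i - 2 * N) with he
  have hl (i : ℕ) (hi : i ≤ 2 * N) : e i = c i := by simp [he, hi]
  have hr (i : ℕ) : e (2 * N + i) = d i := by
    rcases Nat.eq_zero_or_pos i with rfl | hi
    · rw [hd0, ← hcN]; exact hl _ le_rfl
    · simp [he, hi.ne']
  refine ⟨N + M, e, ⟨?_, ?_, fun i hi => ?_⟩, fun i hi => ?_, ?_⟩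
  · rw [hl 0 (by omega), hc0]
  · rw [mul_add, hr, hdM]
  · rcases lt_or_ge i N with h | h
    · rw [hl _ (by omega), hl _ (by omega), hl _ (by omega)]
      exact hc i h
    · obtain ⟨j, rfl⟩ := Nat.exists_eq_add_of_le h
      have := hd j (by omega)
      rwa [← hr, ← hr, ← hr, ← add_assoc, ← add_assoc, ← mul_add] at this
  · rcases le_total i (2 * N) with h | h
    · rw [hl i h]; exact hcS i h
    · obtain ⟨j, rfl⟩ := Nat.exists_eq_add_of_le h
      rw [hr]; exact hdS j (by omega)
  · unfold nullLength
    rw [mul_add, Finset.sum_range_add]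
    congr 1
    · refine Finset.sum_congr rfl fun i hi => ?_
      have := Finset.mem_range.1 hi
      rw [hl _ (by omega), hl _ (by omega)]
    · refine Finset.sum_congr rfl fun i _ => ?_
      rw [add_assoc, hr, hr]

theorem of_past (hp : p ∈ S) (hq : q ∈ S) (h : MinkCausal q p) :
    HasNullChainIn S p q (p.1 - q.1) := by
  have h0 : 0 ≤ p.1 - q.1 := dist_nonneg.trans h
  refine ⟨1, fun i => if i = 0 then p else q, ⟨by simp, by simp, fun i hi => ?_⟩,
    fun i _ => ?_, ?_⟩
  · obtain rfl : i = 0 := by omega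
    simpa [MinkCausal] using h
  · dsimp only
    split_ifs <;> assumption
  · simp [nullLength, Finset.sum_range_succ, abs_sub_comm q.1, abs_of_nonneg h0]

theorem of_future (hp : p ∈ S) (hq : q ∈ S) (h : MinkCausal p q) :
    HasNullChainIn S p q (q.1 - p.1) := by
  have h0 : 0 ≤ q.1 - p.1 := dist_nonneg.trans h
  refine ⟨1, fun i => if i ≤ 1 then p else q, ⟨by simp, by simp, fun i hi => ?_⟩,
    fun i _ => ?_, ?_⟩
  · obtain rfl : i = 0 := by omega
    simpa [MinkCausal] using h
  · dsimp only
    split_ifs <;> assumption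
  · simp [nullLength, Finset.sum_range_succ, abs_of_nonneg h0]

theorem abs_sub_le (h : HasNullChainIn S p q L) : |p.1 - q.1| ≤ L := by
  obtain ⟨N, c, ⟨rfl, rfl, -⟩, -, rfl⟩ := h
  rw [abs_sub_comm, ← Finset.sum_range_sub (fun i => (c i).1)]
  exact Finset.abs_sum_le_sum_abs _ _

theorem dist_le (h : HasNullChainIn S p q L) : dist p.2 q.2 ≤ L := by
  obtain ⟨N, c, ⟨rfl, rfl, hc⟩, -, rfl⟩ := h
  refine (dist_le_range_sum_dist (fun i => (c i).2) (2 * N)).trans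
    (Finset.sum_le_sum fun i hi => ?_)
  have hi' := Finset.mem_range.1 hi
  obtain ⟨j, rfl | rfl⟩ := Nat.even_or_odd' i
  · have := (hc j (by omega)).1
    rw [dist_comm, abs_sub_comm]
    exact this.trans (le_abs_self _)
  · exact (hc j (by omega)).2.trans (le_abs_self _)

end HasNullChainIn

/-- Points of a slab whose spatial distance is at least their time difference, but at most the
height of the slab, are joined by a chain with one turning point, whose spatial projection is
the segment between them. -/
theorem hasNullChainIn_slab_of_dist_le {n : ℕ} {a : ℝ} {p q : ℝ × EuclideanSpace ℝ (Fin n)}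
    (hp : 0 ≤ p.1 ∧ p.1 ≤ a) (hq : 0 ≤ q.1 ∧ q.1 ≤ a) (hpq : |p.1 - q.1| ≤ dist p.2 q.2)
    (hd : dist p.2 q.2 ≤ a) :
    HasNullChainIn {r : ℝ × EuclideanSpace ℝ (Fin n) | 0 ≤ r.1 ∧ r.1 ≤ a} p q
      (dist p.2 q.2) := by
  obtain ⟨h₁, h₂⟩ := abs_le.1 hpq
  have key (s : ℝ) (hs : 0 ≤ s) (hs' : s ≤ dist p.2 q.2) :
      ∃ x, dist p.2 x = s ∧ dist x q.2 = dist p.2 q.2 - s := by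
    rcases (dist_nonneg (x := p.2) (y := q.2)).eq_or_lt with h0 | h0
    · exact ⟨p.2, by rw [dist_self]; linarith, by linarith⟩
    · have h1 : 0 ≤ 1 - s / dist p.2 q.2 := sub_nonneg.2 ((div_le_one h0).2 hs')
      refine ⟨AffineMap.lineMap p.2 q.2 (s / dist p.2 q.2), ?_, ?_⟩
      · rw [dist_left_lineMap, Real.norm_of_nonneg (by positivity)]
        field_simp
      · rw [dist_lineMap_right, Real.norm_of_nonneg h1]
        field_simp
  rcases le_total (dist p.2 q.2) (p.1 + q.1) with h | h
  · obtain ⟨x, hx₁, hx₂⟩ := key ((dist p.2 q.2 + p.1 - q.1) / 2) (by linarith) (by linarith)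
    let m : ℝ × EuclideanSpace ℝ (Fin n) := ((p.1 + q.1 - dist p.2 q.2) / 2, x)
    have hm : 0 ≤ m.1 ∧ m.1 ≤ a := ⟨by dsimp only [m]; linarith, by dsimp only [m]; linarith⟩
    have hmp : MinkCausal m p := by
      dsimp only [MinkCausal, m]; rw [dist_comm]; linarith
    have hmq : MinkCausal m q := by
      dsimp only [MinkCausal, m]; linarith
    convert HasNullChainIn.trans (S := {r | 0 ≤ r.1 ∧ r.1 ≤ a})
      (.of_past hp hm hmp) (.of_future hm hq hmq) using 1
    dsimp only [m]; ring
  · obtain ⟨x, hx₁, hx₂⟩ := key ((dist p.2 q.2 + q.1 - p.1) / 2) (by linarith) (by linarith)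
    let m : ℝ × EuclideanSpace ℝ (Fin n) := ((p.1 + q.1 + dist p.2 q.2) / 2, x)
    have hm : 0 ≤ m.1 ∧ m.1 ≤ a := ⟨by dsimp only [m]; linarith, by dsimp only [m]; linarith⟩
    have hpm : MinkCausal p m := by
      dsimp only [MinkCausal, m]; linarith
    have hqm : MinkCausal q m := by
      dsimp only [MinkCausal, m]; rw [dist_comm]; linarith
    convert HasNullChainIn.trans (S := {r | 0 ≤ r.1 ∧ r.1 ≤ a})
      (.of_future hp hm hpm) (.of_past hm hq hqm) using 1
    dsimp only [m]; ring

theorem hasNullChainIn_slab_of_abs_sub_le {n : ℕ} {a : ℝ} (ha : 0 < a)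
    {p q : ℝ × EuclideanSpace ℝ (Fin n)}
    (hp : 0 ≤ p.1 ∧ p.1 ≤ a) (hq : 0 ≤ q.1 ∧ q.1 ≤ a) (hpq : |p.1 - q.1| ≤ dist p.2 q.2) :
    HasNullChainIn {r : ℝ × EuclideanSpace ℝ (Fin n) | 0 ≤ r.1 ∧ r.1 ≤ a} p q
      (dist p.2 q.2) := by
  obtain ⟨k, hk⟩ : ∃ k : ℕ, dist p.2 q.2 ≤ 2 ^ k * a := by
    obtain ⟨k, hk⟩ := pow_unbounded_of_one_lt (dist p.2 q.2 / a) one_lt_two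
    exact ⟨k, ((div_lt_iff₀ ha).1 hk).le⟩
  induction k generalizing p q with
  | zero => exact hasNullChainIn_slab_of_dist_le hp hq hpq (by simpa using hk)
  | succ k ih =>
    let m : ℝ × EuclideanSpace ℝ (Fin n) := ((p.1 + q.1) / 2, midpoint ℝ p.2 q.2)
    have hm : 0 ≤ m.1 ∧ m.1 ≤ a := ⟨by dsimp only [m]; linarith, by dsimp only [m]; linarith⟩
    have hpm : dist p.2 m.2 = dist p.2 q.2 / 2 := by
      dsimp only [m]; rw [dist_left_midpoint, Real.norm_ofNat]; ring
    have hmq : dist m.2 q.2 = dist p.2 q.2 / 2 := by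
      dsimp only [m]; rw [dist_midpoint_right, Real.norm_ofNat]; ring
    obtain ⟨h₁, h₂⟩ := abs_le.1 hpq
    rw [pow_succ] at hk
    have left := ih hp hm (by rw [hpm, abs_le]; dsimp only [m]; constructor <;> linarith)
      (by linarith)
    have right := ih hm hq (by rw [hmq, abs_le]; dsimp only [m]; constructor <;> linarith)
      (by linarith)
    convert left.trans right using 1
    linarith

theorem hasNullChainIn_slab {n : ℕ} {a : ℝ} (ha : 0 < a) {p q : ℝ × EuclideanSpace ℝ (Fin n)}
    (hp : 0 ≤ p.1 ∧ p.1 ≤ a) (hq : 0 ≤ q.1 ∧ q.1 ≤ a) :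
    HasNullChainIn {r : ℝ × EuclideanSpace ℝ (Fin n) | 0 ≤ r.1 ∧ r.1 ≤ a} p q
      (max |p.1 - q.1| (dist p.2 q.2)) := by
  rcases le_total |p.1 - q.1| (dist p.2 q.2) with h | h
  · rw [max_eq_right h]
    exact hasNullChainIn_slab_of_abs_sub_le ha hp hq h
  · rw [max_eq_left h]
    rcases le_total q.1 p.1 with hqp | hqp
    · rw [abs_of_nonneg (sub_nonneg.2 hqp)] at h ⊢
      exact .of_past hp hq (by rwa [MinkCausal, dist_comm])
    · rw [abs_sub_comm, abs_of_nonneg (sub_nonneg.2 hqp)] at h ⊢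
      exact .of_future hp hq h

/-- On a slab `{0 ≤ t ≤ a}` of Minkowski space, the restricted null distance equals
`max |t₁ - t₂| (dist x₁ x₂)`. -/
theorem nullDistIn_slab (n : ℕ) (a : ℝ) (ha : 0 < a)
    (p q : ℝ × EuclideanSpace ℝ (Fin n))
    (hp : 0 ≤ p.1 ∧ p.1 ≤ a) (hq : 0 ≤ q.1 ∧ q.1 ≤ a) :
    nullDistIn {r : ℝ × EuclideanSpace ℝ (Fin n) | 0 ≤ r.1 ∧ r.1 ≤ a} p q =
      max |p.1 - q.1| (dist p.2 q.2) := by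
  exact IsLeast.csInf_eq ⟨hasNullChainIn_slab ha hp hq,
    fun _ h => max_le (HasNullChainIn.abs_sub_le h) (HasNullChainIn.dist_le h)⟩
end

section
/- Fix n ∈ ℕ, real numbers τ_min < τ_max, and a point P = (t_P, x_P) ∈ ℝ × EuclideanSpace ℝ (Fin n) with τ_min < t_P. Let S = {(t, x) : τ_min < t ∧ t < min t_P τ_max ∧ dist(x, x_P) < t_P − t} be the intersection of the timelike past of P with the slab {τ_min < t < τ_max}. Define the restricted null distance d̂_S(p, q), for p, q ∈ S, as the infimum of the null lengths of null chains from p to q all of whose points lie in S. Then for all p, q ∈ S, d̂_S(p, q) = max(|p.1 − q.1|, dist(p.2, q.2)); in particular the restricted null distance on S agrees with the null distance of Minkowski space. -/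
open Metric

theorem sum_range_two_mul {M : Type*} [AddCommMonoid M] (f : ℕ → M) (N : ℕ) :
    ∑ i ∈ Finset.range (2 * N), f i = ∑ i ∈ Finset.range N, (f (2 * i) + f (2 * i + 1)) := by
  induction N with
  | zero => simp
  | succ N ih =>
    rw [mul_add, mul_one, Finset.sum_range_succ, Finset.sum_range_succ, Finset.sum_range_succ, ih,
      add_assoc]

theorem MinkCausal.dist_le_abs {n : ℕ} {p q : ℝ × EuclideanSpace ℝ (Fin n)}
    (h : MinkCausal q p) : dist p.2 q.2 ≤ |q.1 - p.1| := by
  rw [dist_comm, abs_sub_comm]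
  exact h.trans (le_abs_self _)

theorem IsNullChain.max_le_nullLength {n : ℕ} {p q : ℝ × EuclideanSpace ℝ (Fin n)} {N : ℕ}
    {c : ℕ → ℝ × EuclideanSpace ℝ (Fin n)} (h : IsNullChain p q N c) :
    max |p.1 - q.1| (dist p.2 q.2) ≤ nullLength N c := by
  obtain ⟨rfl, rfl, hc⟩ := h
  refine max_le ?_ ?_
  · refine (dist_le_range_sum_dist (fun i => (c i).1) (2 * N)).trans_eq ?_
    exact Finset.sum_congr rfl fun i _ => by rw [Real.dist_eq, abs_sub_comm]
  · refine (dist_le_range_sum_dist (fun i => (c i).2) (2 * N)).trans ?_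
    rw [nullLength, sum_range_two_mul, sum_range_two_mul]
    refine Finset.sum_le_sum fun i hi => ?_
    obtain ⟨h₁, h₂⟩ := hc i (Finset.mem_range.mp hi)
    refine add_le_add h₁.dist_le_abs ?_
    rw [dist_comm, abs_sub_comm]
    exact h₂.dist_le_abs

/-- A zigzag chain along the segment from `p` to `q` that realises the Minkowski null distance and
stays in the causal past of the segment, at time depth less than `ε`. -/
theorem exists_isNullChain_near_segment {n : ℕ} (p q : ℝ × EuclideanSpace ℝ (Fin n)) {ε : ℝ}
    (hε : 0 < ε) :
    ∃ (N : ℕ) (c : ℕ → ℝ × EuclideanSpace ℝ (Fin n)), IsNullChain p q N c ∧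
      nullLength N c = max |p.1 - q.1| (dist p.2 q.2) ∧
      ∀ i ≤ 2 * N, ∃ r ∈ segment ℝ p q, MinkCausal (c i) r ∧ r.1 - ε < (c i).1 := by
  set T := max |p.1 - q.1| (dist p.2 q.2) with hT
  set A := (T - (q.1 - p.1)) / 2 with hA
  set B := (T + (q.1 - p.1)) / 2 with hB
  have hT₁ : |p.1 - q.1| ≤ T := le_max_left _ _
  have hD : ‖q.2 - p.2‖ ≤ T := by
    rw [← dist_eq_norm, dist_comm]
    exact le_max_right _ _
  have hA₀ : 0 ≤ A := by linarith [neg_abs_le (p.1 - q.1)]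
  have hB₀ : 0 ≤ B := by linarith [le_abs_self (p.1 - q.1)]
  have hT₀ : 0 ≤ T := (abs_nonneg _).trans hT₁
  obtain ⟨a, ha₀, ha₁, haA, haB⟩ : ∃ a : ℝ, 0 ≤ a ∧ a ≤ 1 ∧ a * ‖q.2 - p.2‖ ≤ A ∧
      (1 - a) * ‖q.2 - p.2‖ ≤ B := by
    have hAB : A + B = T := by rw [hA, hB]; ring
    rcases hT₀.eq_or_lt with h | h
    · have : ‖q.2 - p.2‖ = 0 := le_antisymm (hD.trans_eq h.symm) (norm_nonneg _)
      exact ⟨0, le_rfl, zero_le_one, by simpa [this] using hA₀, by simpa [this] using hB₀⟩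
    · have ha : A / T ≤ 1 := (div_le_one h).2 (by linarith)
      have haT : A / T * T = A := div_mul_cancel₀ _ h.ne'
      have ha₀ : 0 ≤ A / T := div_nonneg hA₀ h.le
      refine ⟨A / T, ha₀, ha, ?_, ?_⟩
      · exact (mul_le_mul_of_nonneg_left hD ha₀).trans_eq haT
      · refine (mul_le_mul_of_nonneg_left hD (sub_nonneg.2 ha)).trans_eq ?_
        rw [sub_mul, haT]
        linarith
  obtain ⟨N, hN⟩ := exists_nat_gt (A / ε)
  have hN₀ : (0 : ℝ) < N := (div_nonneg hA₀ hε.le).trans_lt hN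
  set δ : ℝ := (N : ℝ)⁻¹ with hδ
  have hδ₀ : 0 < δ := inv_pos.2 hN₀
  have hNδ : (N : ℝ) * δ = 1 := mul_inv_cancel₀ hN₀.ne'
  have hAδ : A * δ < ε := by
    rw [hδ, ← div_eq_mul_inv, div_lt_iff₀ hN₀, mul_comm]
    exact (div_lt_iff₀ hε).1 hN
  let b : ℕ → ℝ × EuclideanSpace ℝ (Fin n) := fun i => p + ((i : ℝ) * δ) • (q - p)
  let m : ℕ → ℝ × EuclideanSpace ℝ (Fin n) := fun i =>
    ((b i).1 - A * δ, (b i).2 + (a * δ) • (q.2 - p.2))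
  let c : ℕ → ℝ × EuclideanSpace ℝ (Fin n) := fun k => if Even k then b (k / 2) else m (k / 2)
  have hce (i : ℕ) : c (2 * i) = b i := by simp [c]
  have hco (i : ℕ) : c (2 * i + 1) = m i := by
    have : (2 * i + 1) / 2 = i := by omega
    simp [c, this]
  have hmb (i : ℕ) : MinkCausal (m i) (b i) := by
    simp only [MinkCausal, m, dist_self_add_left, norm_smul, Real.norm_eq_abs,
      abs_of_nonneg (mul_nonneg ha₀ hδ₀.le)]
    nlinarith
  have hb₁ (i : ℕ) : (b (i + 1)).1 = (m i).1 + B * δ := by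
    simp only [b, m, Prod.fst_add, Prod.smul_fst, Prod.fst_sub, smul_eq_mul, hA, hB]
    push_cast
    ring
  have hb₂ (i : ℕ) : (b (i + 1)).2 = (m i).2 + ((1 - a) * δ) • (q.2 - p.2) := by
    simp only [b, m, Prod.snd_add, Prod.smul_snd, Prod.snd_sub]
    push_cast
    module
  have hmb' (i : ℕ) : MinkCausal (m i) (b (i + 1)) := by
    rw [MinkCausal, hb₁, hb₂, dist_self_add_right, norm_smul, Real.norm_eq_abs,
      abs_of_nonneg (mul_nonneg (sub_nonneg.2 ha₁) hδ₀.le)]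
    nlinarith
  have hbseg (i : ℕ) (hi : i ≤ N) : b i ∈ segment ℝ p q := by
    rw [segment_eq_image']
    refine ⟨i * δ, ⟨by positivity, ?_⟩, rfl⟩
    rw [← hNδ]
    gcongr
  refine ⟨N, c, ⟨?_, ?_, fun i _ => ?_⟩, ?_, fun k hk => ?_⟩
  · simp [c, b]
  · simp [hce, b, hNδ]
  · rw [hco, hce, show 2 * i + 2 = 2 * (i + 1) by ring, hce]
    exact ⟨hmb i, hmb' i⟩
  · rw [nullLength, sum_range_two_mul]
    have key (i : ℕ) : |(c (2 * i + 1)).1 - (c (2 * i)).1| +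
        |(c (2 * i + 1 + 1)).1 - (c (2 * i + 1)).1| = T * δ := by
      rw [show 2 * i + 1 + 1 = 2 * (i + 1) by ring, hco, hce, hce, hb₁, add_sub_cancel_left,
        abs_of_nonneg (mul_nonneg hB₀ hδ₀.le), abs_sub_comm, show (b i).1 - (m i).1 = A * δ by
          simp [m], abs_of_nonneg (mul_nonneg hA₀ hδ₀.le), hA, hB]
      ring
    simp only [key, Finset.sum_const, Finset.card_range, nsmul_eq_mul]
    rw [mul_left_comm, hNδ, mul_one]
  · obtain ⟨i, rfl | rfl⟩ := Nat.even_or_odd' k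
    · refine ⟨b i, hbseg i (by omega), ?_, ?_⟩
      · simp [hce, MinkCausal]
      · rw [hce]
        linarith
    · refine ⟨b i, hbseg i (by omega), hco i ▸ hmb i, ?_⟩
      rw [hco]
      simp only [m]
      linarith

theorem nullDistIn_eq_of_exists {n : ℕ} {S : Set (ℝ × EuclideanSpace ℝ (Fin n))}
    {p q : ℝ × EuclideanSpace ℝ (Fin n)}
    (h : ∃ (N : ℕ) (c : ℕ → ℝ × EuclideanSpace ℝ (Fin n)), IsNullChain p q N c ∧
      (∀ i ≤ 2 * N, c i ∈ S) ∧ nullLength N c = max |p.1 - q.1| (dist p.2 q.2)) :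
    nullDistIn S p q = max |p.1 - q.1| (dist p.2 q.2) := by
  obtain ⟨N, c, hc, hS, hL⟩ := h
  refine IsLeast.csInf_eq ⟨⟨N, c, hc, hS, hL.symm⟩, ?_⟩
  rintro _ ⟨N', c', hc', -, rfl⟩
  exact hc'.max_le_nullLength

theorem nullDist_eq_nullDistIn_univ {n : ℕ} (p q : ℝ × EuclideanSpace ℝ (Fin n)) :
    nullDist p q = nullDistIn Set.univ p q := by
  simp [nullDist, nullDistIn]

/-- The null distance of Minkowski space. -/
theorem nullDist_eq {n : ℕ} (p q : ℝ × EuclideanSpace ℝ (Fin n)) :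
    nullDist p q = max |p.1 - q.1| (dist p.2 q.2) := by
  rw [nullDist_eq_nullDistIn_univ]
  obtain ⟨N, c, hc, hL, -⟩ := exists_isNullChain_near_segment p q one_pos
  exact nullDistIn_eq_of_exists ⟨N, c, hc, fun _ _ => Set.mem_univ _, hL⟩

theorem convex_timelike_past {n : ℕ} (tP : ℝ) (xP : EuclideanSpace ℝ (Fin n)) :
    Convex ℝ {r : ℝ × EuclideanSpace ℝ (Fin n) | dist r.2 xP < tP - r.1} := by
  have h : ConvexOn ℝ Set.univ fun r : ℝ × EuclideanSpace ℝ (Fin n) => dist r.2 xP + r.1 :=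
    ((convexOn_univ_dist xP).comp_linearMap (LinearMap.snd ℝ ℝ _)).add
      ((LinearMap.fst ℝ ℝ _).convexOn convex_univ)
  simpa [lt_sub_iff_add_lt] using h.convex_lt tP

/-- On the intersection of the timelike past of a point `P = (t_P, x_P)` with the slab
`{τ_min < t < τ_max}`, the restricted null distance agrees with the null distance of
Minkowski space: it equals `max |p.1 - q.1| (dist p.2 q.2)`. -/
theorem nullDistIn_past_of_point (n : ℕ) (τmin τmax : ℝ) (hτ : τmin < τmax)
    (tP : ℝ) (xP : EuclideanSpace ℝ (Fin n)) (htP : τmin < tP)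
    (p q : ℝ × EuclideanSpace ℝ (Fin n))
    (hp : p ∈ {r : ℝ × EuclideanSpace ℝ (Fin n) |
      τmin < r.1 ∧ r.1 < min tP τmax ∧ dist r.2 xP < tP - r.1})
    (hq : q ∈ {r : ℝ × EuclideanSpace ℝ (Fin n) |
      τmin < r.1 ∧ r.1 < min tP τmax ∧ dist r.2 xP < tP - r.1}) :
    nullDistIn {r : ℝ × EuclideanSpace ℝ (Fin n) |
        τmin < r.1 ∧ r.1 < min tP τmax ∧ dist r.2 xP < tP - r.1} p q =
      max |p.1 - q.1| (dist p.2 q.2) ∧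
    nullDistIn {r : ℝ × EuclideanSpace ℝ (Fin n) |
        τmin < r.1 ∧ r.1 < min tP τmax ∧ dist r.2 xP < tP - r.1} p q = nullDist p q := by
  refine (fun h => ⟨h, h.trans (nullDist_eq p q).symm⟩) (nullDistIn_eq_of_exists ?_)
  obtain ⟨hp₁, hp₂, hp₃⟩ := hp
  obtain ⟨hq₁, hq₂, hq₃⟩ := hq
  obtain ⟨N, c, hc, hL, hseg⟩ :=
    exists_isNullChain_near_segment p q (sub_pos.2 (lt_min hp₁ hq₁))
  refine ⟨N, c, hc, fun i hi => ?_, hL⟩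
  obtain ⟨r, hr, hcr, hε⟩ := hseg i hi
  have hr₁ : r.1 ∈ Set.Ico (min p.1 q.1) (min tP τmax) :=
    ((convex_Ico _ _).linear_preimage (LinearMap.fst ℝ ℝ _)).segment_subset
      ⟨min_le_left _ _, hp₂⟩ ⟨min_le_right _ _, hq₂⟩ hr
  have hr₃ : dist r.2 xP < tP - r.1 := (convex_timelike_past tP xP).segment_subset hp₃ hq₃ hr
  have hcr' : dist (c i).2 r.2 ≤ r.1 - (c i).1 := hcr
  have hle : (c i).1 ≤ r.1 := sub_nonneg.1 (dist_nonneg.trans hcr')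
  refine ⟨by linarith [hr₁.1], hle.trans_lt hr₁.2, ?_⟩
  linarith [dist_triangle (c i).2 r.2 xP]
end
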